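/- arXiv:0809.0724 — 4 statements merged into one kernel-verified Lean document; each statement's English description precedes it below -/
import Mathlib

section
/- Let r ≥ 2 and d ≥ 1 be integers, and let V₁, …, V_r be the colour classes of a proper r-colouring of a finite simple graph H. Suppose that |V_i| ≥ 2e(2r−3)d for all i ∈ {1, …, r} (where e is Euler's number), and that the induced subgraph H[V_i ∪ V_j] is d-degenerate for all distinct i, j ∈ {1, …, r}. Then there exists an independent set {x₁, …, x_r} of H with x_i ∈ V_i for each i. -/
open SimpleGraph

/-- `H` is a minor of `G`: there are nonempty, pairwise disjoint, connected
branch sets in `G`, one for each vertex of `H`, such that adjacent vertices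
of `H` have an edge of `G` between their branch sets. -/
def MinorOf {α β : Type*} (H : SimpleGraph α) (G : SimpleGraph β) : Prop :=
  ∃ B : α → Set β,
    (Pairwise fun a b => Disjoint (B a) (B b)) ∧
    (∀ a, (G.induce (B a)).Connected) ∧
    (∀ a b, H.Adj a b → ∃ u ∈ B a, ∃ v ∈ B b, G.Adj u v)

/-- A tree decomposition of a graph `G`. -/
structure TreeDecomp {V : Type} (G : SimpleGraph V) where
  ι : Type
  tree : SimpleGraph ι
  isTree : tree.IsTree
  bag : ι → Finset V
  mem_bag : ∀ v : V, ∃ i, v ∈ bag i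
  adj_bag : ∀ u v : V, G.Adj u v → ∃ i, u ∈ bag i ∧ v ∈ bag i
  connected_bag : ∀ v : V, (tree.induce {i | v ∈ bag i}).Connected

/-- The width of a tree decomposition: maximum bag size minus one. -/
noncomputable def TreeDecomp.width {V : Type} {G : SimpleGraph V}
    (td : TreeDecomp G) : ℕ :=
  sSup {n | ∃ i, n = (td.bag i).card} - 1

/-- The treewidth of a finite graph. -/
noncomputable def treewidth {V : Type} [Fintype V] (G : SimpleGraph V) : ℕ :=
  sInf {w | ∃ td : TreeDecomp G, td.width = w}

/-- A path in `G`, together with its endpoints. -/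
def PathIn {V : Type} (G : SimpleGraph V) : Type := Σ u v : V, G.Path u v

/-- The set of vertices of a path. -/
def PathIn.verts {V : Type} {G : SimpleGraph V} (P : PathIn G) : Set V :=
  {v | v ∈ (P.2.2 : G.Walk P.1 P.2.1).support}

/-- The intersection graph of a set of paths: two paths are adjacent iff they
are distinct and share a vertex. -/
def pathIntersectionGraph {V : Type} (G : SimpleGraph V)
    (𝒬 : Set (PathIn G)) : SimpleGraph 𝒬 :=
  SimpleGraph.fromRel fun P Q => ∃ v, v ∈ (P : PathIn G).verts ∧ v ∈ (Q : PathIn G).verts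

/-- A grid-like-minor of order `ℓ` in `G`: a set of paths whose intersection
graph is bipartite and contains a `K_ℓ`-minor. -/
def IsGridLikeMinor {V : Type} (G : SimpleGraph V) (ℓ : ℕ)
    (𝒬 : Set (PathIn G)) : Prop :=
  (pathIntersectionGraph G 𝒬).Colorable 2 ∧
    MinorOf (completeGraph (Fin ℓ)) (pathIntersectionGraph G 𝒬)

/-- Two subgraphs touch if they share a vertex or there is an edge of `G`
between them. -/
def Touch {V : Type} {G : SimpleGraph V} (X Y : G.Subgraph) : Prop :=
  (X.verts ∩ Y.verts).Nonempty ∨ ∃ u ∈ X.verts, ∃ v ∈ Y.verts, G.Adj u v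

/-- A bramble: a set of pairwise touching connected subgraphs. -/
def IsBramble {V : Type} {G : SimpleGraph V} (ℬ : Set G.Subgraph) : Prop :=
  (∀ X ∈ ℬ, X.Connected) ∧ ∀ X ∈ ℬ, ∀ Y ∈ ℬ, Touch X Y

/-- The order of a bramble is at least `k`: every hitting set has at least `k`
vertices. -/
def BrambleOrderAtLeast {V : Type} {G : SimpleGraph V} (ℬ : Set G.Subgraph)
    (k : ℕ) : Prop :=
  ∀ S : Finset V, (∀ X ∈ ℬ, ∃ v ∈ S, v ∈ X.verts) → k ≤ S.card

/-- The intersection graph of a set of subgraphs: two subgraphs are adjacent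
iff they are distinct and share a vertex. -/
def subgraphIntersectionGraph {V : Type} (G : SimpleGraph V)
    (𝒳 : Set G.Subgraph) : SimpleGraph 𝒳 :=
  SimpleGraph.fromRel fun X Q => ((X : G.Subgraph).verts ∩ (Q : G.Subgraph).verts).Nonempty

/-- A graph is `d`-degenerate if every nonempty (induced) subgraph has a vertex
of degree at most `d`. -/
def IsDegenerate {W : Type*} (d : ℕ) (G : SimpleGraph W) : Prop :=
  ∀ s : Set W, s.Nonempty → ∃ v ∈ s, {u | u ∈ s ∧ G.Adj v u}.ncard ≤ d

open Classical in
/-- The number of adjacent pairs between two disjoint sets `A` and `B`, restricted to a set `s` all of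
whose nonempty subsets contain a vertex of relative degree at most `d`, is at most `d * #s`. -/
theorem card_adj_pairs_le_of_degenerate {V : Type*} (H : SimpleGraph V) (d : ℕ)
    {A B : Finset V} (hAB : Disjoint A B) (s : Finset V)
    (hs : ∀ t ⊆ s, t.Nonempty → ∃ v ∈ t, (t.filter (H.Adj v)).card ≤ d) :
    (((s ∩ A) ×ˢ (s ∩ B)).filter fun p => H.Adj p.1 p.2).card ≤ d * s.card := by
  induction s using Finset.strongInduction with
  | H s ih =>
    rcases s.eq_empty_or_nonempty with rfl | hne
    · simp
    obtain ⟨v, hv, hdv⟩ := hs s subset_rfl hne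
    have hrec := ih (s.erase v) (Finset.erase_ssubset hv)
      fun t ht => hs t (ht.trans (Finset.erase_subset _ _))
    have hcard : s.card = (s.erase v).card + 1 := (Finset.card_erase_add_one hv).symm
    let g : V → V × V := if v ∈ A then fun u => (v, u) else fun u => (u, v)
    have hsub : (((s ∩ A) ×ˢ (s ∩ B)).filter fun p => H.Adj p.1 p.2) ⊆
        ((((s.erase v) ∩ A) ×ˢ ((s.erase v) ∩ B)).filter fun p => H.Adj p.1 p.2) ∪
          (s.filter (H.Adj v)).image g := by
      rintro ⟨a, b⟩ hp
      simp only [Finset.mem_filter, Finset.mem_product, Finset.mem_inter, Finset.mem_union,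
        Finset.mem_image, Finset.mem_erase] at hp ⊢
      obtain ⟨⟨⟨has, haA⟩, hbs, hbB⟩, hadj⟩ := hp
      by_cases hvA : v ∈ A
      · have hbv : b ≠ v := fun h => Finset.disjoint_left.mp hAB hvA (h ▸ hbB)
        by_cases hav : a = v
        · subst hav
          exact Or.inr ⟨b, ⟨hbs, hadj⟩, by simp [g, hvA]⟩
        · exact Or.inl ⟨⟨⟨⟨hav, has⟩, haA⟩, ⟨hbv, hbs⟩, hbB⟩, hadj⟩
      · have hav : a ≠ v := fun h => hvA (h ▸ haA)
        by_cases hbv : b = v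
        · subst hbv
          exact Or.inr ⟨a, ⟨has, hadj.symm⟩, by simp [g, hvA]⟩
        · exact Or.inl ⟨⟨⟨⟨hav, has⟩, haA⟩, ⟨hbv, hbs⟩, hbB⟩, hadj⟩
    have h1 := (Finset.card_le_card hsub).trans (Finset.card_union_le _ _)
    have h2 : ((s.filter (H.Adj v)).image g).card ≤ d := Finset.card_image_le.trans hdv
    rw [hcard, mul_add, mul_one]
    omega

open Classical in
/-- The choice functions of the family `W` whose values at distinct indices in `S` are
pairwise nonadjacent. -/
noncomputable def independentChoices {ι V : Type*} [Fintype ι] (H : SimpleGraph V)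
    (W : ι → Finset V) (S : Finset ι) : Finset (ι → V) :=
  (Fintype.piFinset W).filter fun f => ∀ i ∈ S, ∀ j ∈ S, i ≠ j → ¬ H.Adj (f i) (f j)

theorem mem_independentChoices {ι V : Type*} [Fintype ι] {H : SimpleGraph V}
    {W : ι → Finset V} {S : Finset ι} {f : ι → V} :
    f ∈ independentChoices H W S ↔
      (∀ i, f i ∈ W i) ∧ ∀ i ∈ S, ∀ j ∈ S, i ≠ j → ¬ H.Adj (f i) (f j) := by
  simp [independentChoices]

open Classical in
/-- Conflicts between two coordinates outside `S` are independent of the choices on `S`. -/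
theorem card_filter_adj_mul_le {ι V : Type*} [Fintype ι] {H : SimpleGraph V}
    {W : ι → Finset V} {k m : ℕ} (hk : 0 < k) (hW : ∀ i, (W i).card = k)
    {u v : ι} (huv : u ≠ v) {S : Finset ι} (hu : u ∉ S) (hv : v ∉ S)
    (hE : ((W u ×ˢ W v).filter fun p => H.Adj p.1 p.2).card ≤ m * k) :
    k * ((independentChoices H W S).filter fun f => H.Adj (f u) (f v)).card ≤
      m * (independentChoices H W S).card := by
  set B := independentChoices H W S
  set E := (W u ×ˢ W v).filter fun p => H.Adj p.1 p.2
  have key : ((B.filter fun f => H.Adj (f u) (f v)) ×ˢ (W u ×ˢ W v)).card ≤ (B ×ˢ E).card := by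
    refine Finset.card_le_card_of_injOn
      (fun q => (Function.update (Function.update q.1 u q.2.1) v q.2.2, (q.1 u, q.1 v))) ?_ ?_
    · rintro ⟨f, a, b⟩ hq
      simp only [Finset.coe_product, Set.mem_prod, Finset.mem_coe, Finset.mem_filter, B, E,
        mem_independentChoices, Finset.mem_product] at hq ⊢
      obtain ⟨⟨⟨hfW, hfS⟩, hadj⟩, ha, hb⟩ := hq
      have hne : ∀ i ∈ S, i ≠ u ∧ i ≠ v := fun i hi =>
        ⟨fun h => hu (h ▸ hi), fun h => hv (h ▸ hi)⟩
      refine ⟨⟨fun i => ?_, fun i hi j hj hij => ?_⟩, ⟨hfW u, hfW v⟩, hadj⟩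
      · by_cases hiv : i = v
        · subst hiv; simpa using hb
        by_cases hiu : i = u
        · subst hiu; simpa [hiv] using ha
        simpa [hiv, hiu] using hfW i
      · simpa [(hne i hi).1, (hne i hi).2, (hne j hj).1, (hne j hj).2] using hfS i hi j hj hij
    · rintro ⟨f, a, b⟩ - ⟨f', a', b'⟩ - h
      simp only [Prod.mk.injEq] at h ⊢
      obtain ⟨hup, hfu, hfv⟩ := h
      have hval := fun i => congrFun hup i
      refine ⟨funext fun i => ?_, ?_, ?_⟩
      · by_cases hiv : i = v
        · subst hiv; exact hfv
        by_cases hiu : i = u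
        · subst hiu; exact hfu
        simpa [hiv, hiu] using hval i
      · simpa [huv] using hval u
      · simpa using hval v
  simp only [Finset.card_product, hW] at key
  have h2 := key.trans (Nat.mul_le_mul_left B.card hE)
  refine Nat.le_of_mul_le_mul_right (c := k) ?_ hk
  nlinarith [h2]

open Classical in
/-- Passing from `T` to `insert v T` loses at most the choices with a conflict between `v` and
some element of `T`. -/
theorem mul_card_independentChoices_le {ι V : Type*} [Fintype ι] {H : SimpleGraph V}
    {W : ι → Finset V} {k m : ℕ} (hk : 0 < k) (hW : ∀ i, (W i).card = k)
    (hE : ∀ u v, u ≠ v → ((W u ×ˢ W v).filter fun p => H.Adj p.1 p.2).card ≤ m * k)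
    {v : ι} {T : Finset ι} (hv : v ∉ T) :
    k * (independentChoices H W T).card ≤ k * (independentChoices H W (insert v T)).card +
      ∑ u ∈ T, m * (independentChoices H W (T.erase u)).card := by
  have hsub : independentChoices H W T ⊆ independentChoices H W (insert v T) ∪
      T.biUnion fun u => (independentChoices H W (T.erase u)).filter
        fun f => H.Adj (f u) (f v) := by
    intro f hf
    rw [mem_independentChoices] at hf
    obtain ⟨hfW, hfT⟩ := hf
    by_cases hc : ∃ u ∈ T, H.Adj (f u) (f v)
    · obtain ⟨u, hu, hadj⟩ := hc
      refine Finset.mem_union_right _ (Finset.mem_biUnion.mpr ⟨u, hu, ?_⟩)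
      exact Finset.mem_filter.mpr ⟨mem_independentChoices.mpr ⟨hfW, fun i hi j hj =>
        hfT i (Finset.mem_of_mem_erase hi) j (Finset.mem_of_mem_erase hj)⟩, hadj⟩
    · push Not at hc
      refine Finset.mem_union_left _ (mem_independentChoices.mpr ⟨hfW, fun i hi j hj hij => ?_⟩)
      rcases Finset.mem_insert.mp hi with rfl | hiT
      · rcases Finset.mem_insert.mp hj with rfl | hjT
        · exact absurd rfl hij
        · exact fun h => hc j hjT h.symm
      · rcases Finset.mem_insert.mp hj with rfl | hjT
        · exact hc i hiT
        · exact hfT i hiT j hjT hij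
  have h1 := (Finset.card_le_card hsub).trans ((Finset.card_union_le _ _).trans
    (Nat.add_le_add_left Finset.card_biUnion_le _))
  refine (Nat.mul_le_mul_left k h1).trans ?_
  rw [mul_add, Finset.mul_sum]
  refine Nat.add_le_add_left (Finset.sum_le_sum fun u hu => ?_) _
  have huv : u ≠ v := fun h => hv (h ▸ hu)
  exact card_filter_adj_mul_le hk hW huv (Finset.notMem_erase u T)
    (fun h => hv (Finset.mem_of_mem_erase h)) (hE u v huv)

open Classical in
/-- Adding one index to `T` at most halves the number of independent choices. -/
theorem card_independentChoices_le_two_mul {ι V : Type*} [Fintype ι] {H : SimpleGraph V}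
    {W : ι → Finset V} {k m : ℕ} (hk : 0 < k) (hW : ∀ i, (W i).card = k)
    (hE : ∀ u v, u ≠ v → ((W u ×ˢ W v).filter fun p => H.Adj p.1 p.2).card ≤ m * k)
    (T : Finset ι) (v : ι) (hv : v ∉ T) (hT : 4 * m * T.card ≤ k) :
    (independentChoices H W T).card ≤ 2 * (independentChoices H W (insert v T)).card := by
  induction T using Finset.strongInduction generalizing v with
  | H T ih =>
    have h1 := mul_card_independentChoices_le hk hW hE hv
    have h2 : ∑ u ∈ T, m * (independentChoices H W (T.erase u)).card ≤
        T.card * (m * (2 * (independentChoices H W T).card)) := by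
      rw [← smul_eq_mul]
      refine Finset.sum_le_card_nsmul _ _ _ fun u hu => Nat.mul_le_mul_left m ?_
      have := ih (T.erase u) (Finset.erase_ssubset hu) u (Finset.notMem_erase u T)
        ((Nat.mul_le_mul_left _ (Finset.card_le_card (Finset.erase_subset u T))).trans hT)
      rwa [Finset.insert_erase hu] at this
    refine le_of_mul_le_mul_left (a := k) ?_ hk
    have h3 := Nat.mul_le_mul_right (independentChoices H W T).card hT
    nlinarith

open Classical in
/-- If the classes `W i` have common size `k` and each pair of classes spans at most `m * k`
edges, with `m` small compared to `k` over the number of classes, there is an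
independent choice function. -/
theorem exists_independent_choice {ι V : Type*} [Fintype ι] {H : SimpleGraph V}
    {W : ι → Finset V} {k m : ℕ} (hW : ∀ i, (W i).card = k)
    (hE : ∀ u v, u ≠ v → ((W u ×ˢ W v).filter fun p => H.Adj p.1 p.2).card ≤ m * k)
    (hk₁ : 4 * m * (Fintype.card ι - 2) ≤ k) (hk₂ : 2 * m * (Fintype.card ι - 1) < k) :
    ∃ x : ι → V, (∀ i, x i ∈ W i) ∧ ∀ i j, i ≠ j → ¬ H.Adj (x i) (x j) := by
  have hk : 0 < k := by omega
  have hpos : ∀ T : Finset ι, 0 < (independentChoices H W T).card := by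
    intro T
    induction T using Finset.induction_on with
    | empty =>
      choose f hf using fun i => Finset.card_pos.mp ((hW i).symm ▸ hk)
      exact Finset.card_pos.mpr ⟨f, mem_independentChoices.mpr ⟨hf, by simp⟩⟩
    | insert v T hv ihT =>
      have hcard : T.card + 1 ≤ Fintype.card ι := by
        rw [← Finset.card_insert_of_notMem hv]
        exact Finset.card_le_univ _
      have h1 := mul_card_independentChoices_le hk hW hE hv
      have h2 : ∑ u ∈ T, m * (independentChoices H W (T.erase u)).card ≤
          T.card * (m * (2 * (independentChoices H W T).card)) := by
        rw [← smul_eq_mul]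
        refine Finset.sum_le_card_nsmul _ _ _ fun u hu => Nat.mul_le_mul_left m ?_
        have hc := Finset.card_erase_of_mem hu
        have := card_independentChoices_le_two_mul hk hW hE (T.erase u) u
          (Finset.notMem_erase u T)
          ((Nat.mul_le_mul_left _ (by omega)).trans hk₁)
        rwa [Finset.insert_erase hu] at this
      have h3 : 2 * m * T.card < k :=
        (Nat.mul_le_mul_left (2 * m) (by omega : T.card ≤ Fintype.card ι - 1)).trans_lt hk₂
      have h4 := Nat.mul_lt_mul_of_pos_right h3 ihT
      refine pos_of_mul_pos_right (a := k) ?_ hk.le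
      nlinarith
  obtain ⟨x, hx⟩ := Finset.card_pos.mp (hpos Finset.univ)
  rw [mem_independentChoices] at hx
  exact ⟨x, hx.1, fun i j hij => hx.2 i (Finset.mem_univ _) j (Finset.mem_univ _) hij⟩

open Classical in
/-- Degeneracy of an induced subgraph, in terms of finsets of vertices of the ambient graph. -/
theorem IsDegenerate.exists_card_filter_adj_le {V : Type*} {H : SimpleGraph V} {X : Set V} {d : ℕ}
    (h : IsDegenerate d (H.induce X)) (t : Finset V) (ht : (t : Set V) ⊆ X) (hne : t.Nonempty) :
    ∃ v ∈ t, (t.filter (H.Adj v)).card ≤ d := by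
  obtain ⟨w, hw⟩ := hne
  obtain ⟨v, hv, hd⟩ := h {y | (y : V) ∈ t} ⟨⟨w, ht hw⟩, hw⟩
  refine ⟨v, hv, ?_⟩
  rw [← Set.ncard_image_of_injective _ Subtype.val_injective] at hd
  rw [← Set.ncard_coe_finset]
  convert hd using 2
  ext u
  simp only [Finset.coe_filter, Set.mem_ofPred_eq, Set.mem_image, SimpleGraph.comap_adj,
    Function.Embedding.subtype_apply]
  constructor
  · rintro ⟨hu, ha⟩
    exact ⟨⟨u, ht hu⟩, ⟨hu, ha⟩, rfl⟩
  · rintro ⟨y, ⟨hy, ha⟩, rfl⟩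
    exact ⟨hy, ha⟩

/-- If each colour class of a proper `r`-colouring of `H` has at least
`2e(2r-3)d` vertices, and every two colour classes induce a `d`-degenerate
subgraph, then `H` has an independent set with one vertex per class. -/
theorem rainbow_independent_set_of_degenerate {V : Type} [Fintype V]
    {H : SimpleGraph V} (r d : ℕ) (hr : 2 ≤ r) (hd : 1 ≤ d)
    (C : Fin r → Set V)
    (hpart : ∀ v : V, ∃! i, v ∈ C i)
    (hindep : ∀ i, ∀ u ∈ C i, ∀ v ∈ C i, ¬ H.Adj u v)
    (hsize : ∀ i, 2 * Real.exp 1 * (2 * (r : ℝ) - 3) * d ≤ ((C i).ncard : ℝ))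
    (hdeg : ∀ i j, i ≠ j → IsDegenerate d (H.induce (C i ∪ C j))) :
    ∃ x : Fin r → V, (∀ i, x i ∈ C i) ∧
      ∀ i j, i ≠ j → ¬ H.Adj (x i) (x j) := by
  classical
  set k := ⌈2 * Real.exp 1 * (2 * (r : ℝ) - 3) * d⌉₊
  have hle : ∀ i, k ≤ (C i).toFinset.card := fun i => by
    rw [← Set.ncard_eq_toFinset_card']
    exact Nat.ceil_le.mpr (hsize i)
  choose W hWsub hWcard using fun i => Finset.exists_subset_card_eq (hle i)
  have hWC : ∀ i, ∀ v ∈ W i, v ∈ C i := fun i v hv => Set.mem_toFinset.mp (hWsub i hv)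
  have hk : 2 * Real.exp 1 * (2 * (r : ℝ) - 3) * d ≤ k := Nat.le_ceil _
  have hr' : (2 : ℝ) ≤ r := by exact_mod_cast hr
  have hd' : (1 : ℝ) ≤ d := by exact_mod_cast hd
  have hk' : 5.4 * (2 * (r : ℝ) - 3) * d ≤ k := by
    refine le_trans ?_ hk
    have := Real.exp_one_gt_d9
    gcongr
    · linarith
    · linarith
  suffices h : ∃ x : Fin r → V, (∀ i, x i ∈ W i) ∧ ∀ i j, i ≠ j → ¬ H.Adj (x i) (x j) by
    obtain ⟨x, hxW, hx⟩ := h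
    exact ⟨x, fun i => hWC i _ (hxW i), hx⟩
  refine exists_independent_choice (k := k) (m := 2 * d) hWcard ?_ ?_ ?_
  · intro u v huv
    have hdisj : Disjoint (W u) (W v) := Finset.disjoint_left.mpr fun a ha hb =>
      huv ((hpart a).unique (hWC u a ha) (hWC v a hb))
    have h := card_adj_pairs_le_of_degenerate H d hdisj (W u ∪ W v) fun t ht hne =>
      (hdeg u v huv).exists_card_filter_adj_le t (fun a ha => by
        rcases Finset.mem_union.mp (ht ha) with h | h
        · exact Or.inl (hWC u a h)
        · exact Or.inr (hWC v a h)) hne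
    rw [Finset.inter_eq_right.mpr Finset.subset_union_left,
      Finset.inter_eq_right.mpr Finset.subset_union_right,
      Finset.card_union_of_disjoint hdisj, hWcard, hWcard] at h
    linarith
  · rw [Fintype.card_fin]
    have : ((4 * (2 * d) * (r - 2) : ℕ) : ℝ) ≤ k := by
      push_cast [Nat.cast_sub hr]
      nlinarith
    exact_mod_cast this
  · rw [Fintype.card_fin]
    have : ((2 * (2 * d) * (r - 1) : ℕ) : ℝ) < k := by
      push_cast [Nat.cast_sub (by omega : 1 ≤ r)]
      nlinarith
    exact_mod_cast this
end

section
/- Let V₁, …, V_r be the colour classes of a proper r-colouring of a finite simple graph H. For each i ∈ {1, …, r}, let n_i := |V_i| and let m_i be the number of edges of H with at least one endpoint in V_i. Suppose there is a real number t > 0 such that n_i ≥ 2e·t and m_i ≤ t·n_i for all i ∈ {1, …, r} (where e is Euler's number). Then there exists an independent set {x₁, …, x_r} of H with x_i ∈ V_i for each i. -/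
open SimpleGraph

/-- The independent partial transversals of the fibres of `c` over `S`, encoded as total functions
that agree with `d` outside `S`. -/
def partialTransversals {V ι : Type*} [Fintype V] [DecidableEq V] [Fintype ι] [DecidableEq ι]
    (H : SimpleGraph V) [DecidableRel H.Adj] (c : V → ι) (d : ι → V) (S : Finset ι) : Finset (ι → V) :=
  Finset.univ.filter fun x => (∀ i ∈ S, c (x i) = i) ∧ (∀ i ∉ S, x i = d i) ∧
    ∀ i ∈ S, ∀ j ∈ S, ¬ H.Adj (x i) (x j)

section PartialTransversals

variable {V ι : Type*} [Fintype V] [DecidableEq V] [Fintype ι] [DecidableEq ι]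
  {H : SimpleGraph V} [DecidableRel H.Adj] {c : V → ι} {d : ι → V} {S : Finset ι}

theorem mem_partialTransversals {x : ι → V} :
    x ∈ partialTransversals H c d S ↔ (∀ i ∈ S, c (x i) = i) ∧ (∀ i ∉ S, x i = d i) ∧
      ∀ i ∈ S, ∀ j ∈ S, ¬ H.Adj (x i) (x j) := by
  simp [partialTransversals]

theorem card_filter_partialTransversals_le (j : ι) (w : V) :
    ((partialTransversals H c d S).filter fun x => x j = w).card ≤
      (partialTransversals H c d (S.erase j)).card := by
  refine Finset.card_le_card_of_injOn (fun x => Function.update x j (d j)) ?_ ?_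
  · intro x hx
    simp only [Finset.coe_filter, Set.mem_ofPred_eq, mem_partialTransversals] at hx
    obtain ⟨⟨hc, hd, hadj⟩, -⟩ := hx
    simp only [Finset.mem_coe, mem_partialTransversals, Finset.mem_erase]
    refine ⟨fun i hi => ?_, fun i hi => ?_, fun a ha b hb => ?_⟩
    · rw [Function.update_of_ne hi.1]; exact hc i hi.2
    · by_cases hij : i = j
      · subst hij; simp
      · rw [Function.update_of_ne hij]; exact hd i fun h => hi ⟨hij, h⟩
    · rw [Function.update_of_ne ha.1, Function.update_of_ne hb.1]
      exact hadj a ha.2 b hb.2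
  · intro x hx y hy hxy
    simp only [Finset.coe_filter, Set.mem_ofPred_eq] at hx hy
    funext k
    by_cases hk : k = j
    · subst hk; rw [hx.2, hy.2]
    · simpa [Function.update_of_ne hk] using congrFun hxy k

/-- Extending a partial transversal by a vertex of a new fibre fails only because of an edge from
that vertex to the transversal. -/
theorem card_mul_card_partialTransversals_le {i : ι} (hi : i ∉ S) :
    (Finset.univ.filter fun v => c v = i).card * (partialTransversals H c d S).card ≤
      (partialTransversals H c d (insert i S)).card +
        ∑ p ∈ Finset.univ.filter (fun p : V × V => c p.1 = i ∧ c p.2 ∈ S ∧ H.Adj p.1 p.2),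
          (partialTransversals H c d (S.erase (c p.2))).card := by
  set T := partialTransversals H c d S with hT
  rw [← Finset.card_product,
    ← Finset.card_filter_add_card_filter_not (fun q : V × (ι → V) => ∀ j ∈ S, ¬ H.Adj q.1 (q.2 j))]
  refine Nat.add_le_add ?_ ?_
  · refine Finset.card_le_card_of_injOn (fun q => Function.update q.2 i q.1) ?_ ?_
    · rintro ⟨v, x⟩ hq
      simp only [hT, Finset.coe_filter, Finset.mem_product, Finset.mem_filter, Finset.mem_univ,
        true_and, Set.mem_ofPred_eq, mem_partialTransversals] at hq
      obtain ⟨⟨hv, hc, hd, hadj⟩, hgood⟩ := hq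
      have hne : ∀ a ∈ S, a ≠ i := fun a ha h => hi (h ▸ ha)
      simp only [Finset.mem_coe, mem_partialTransversals, Finset.mem_insert]
      refine ⟨?_, ?_, ?_⟩
      · rintro a (rfl | ha)
        · simpa using hv
        · rw [Function.update_of_ne (hne a ha)]; exact hc a ha
      · intro a ha
        rw [Function.update_of_ne fun h => ha (Or.inl h)]
        exact hd a fun h => ha (Or.inr h)
      · rintro a (rfl | ha) b (rfl | hb)
        · simp
        · rw [Function.update_self, Function.update_of_ne (hne b hb)]; exact hgood b hb
        · rw [Function.update_self, Function.update_of_ne (hne a ha)]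
          exact fun h => hgood a ha h.symm
        · rw [Function.update_of_ne (hne a ha), Function.update_of_ne (hne b hb)]
          exact hadj a ha b hb
    · rintro ⟨v, x⟩ hx ⟨w, y⟩ hy hxy
      simp only [hT, Finset.coe_filter, Finset.mem_product, Finset.mem_filter, Finset.mem_univ,
        true_and, Set.mem_ofPred_eq, mem_partialTransversals] at hx hy
      refine Prod.ext (by simpa using congrFun hxy i) (funext fun k => ?_)
      by_cases hk : k = i
      · subst hk; exact (hx.1.2.2.1 k hi).trans (hy.1.2.2.1 k hi).symm
      · simpa [Function.update_of_ne hk] using congrFun hxy k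
  · set P := Finset.univ.filter (fun p : V × V => c p.1 = i ∧ c p.2 ∈ S ∧ H.Adj p.1 p.2)
    calc _ ≤ (P.biUnion fun p => ({p.1} : Finset V) ×ˢ T.filter fun x => x (c p.2) = p.2).card := by
          refine Finset.card_le_card ?_
          rintro ⟨v, x⟩ hq
          simp only [Finset.mem_filter, Finset.mem_product, Finset.mem_univ, true_and] at hq
          obtain ⟨⟨hv, hx⟩, hbad⟩ := hq
          push Not at hbad
          obtain ⟨j, hj, hvj⟩ := hbad
          have hcj := (mem_partialTransversals.1 hx).1 j hj
          simp only [Finset.mem_biUnion, Finset.mem_product, Finset.mem_singleton,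
            Finset.mem_filter]
          exact ⟨(v, x j), by simp [P, hv, hcj, hj, hvj], rfl, hx, by simp [hcj]⟩
      _ ≤ ∑ p ∈ P, (({p.1} : Finset V) ×ˢ T.filter fun x => x (c p.2) = p.2).card :=
          Finset.card_biUnion_le
      _ ≤ _ := Finset.sum_le_sum fun p _ => by
          rw [Finset.card_product, Finset.card_singleton, one_mul]
          exact card_filter_partialTransversals_le _ _

theorem card_partialTransversals_insert_ge {t : ℝ} (ht : 0 < t)
    (hsize : ∀ i, 4 * t ≤ ((Finset.univ.filter fun v => c v = i).card : ℝ))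
    (hedges : ∀ i, ((Finset.univ.filter fun p : V × V => c p.1 = i ∧ H.Adj p.1 p.2).card : ℝ) ≤
      t * (Finset.univ.filter fun v => c v = i).card)
    (S : Finset ι) : ∀ i ∉ S,
      ((Finset.univ.filter fun v => c v = i).card : ℝ) * (partialTransversals H c d S).card ≤
        2 * (partialTransversals H c d (insert i S)).card := by
  induction S using Finset.strongInduction with
  | H S ih =>
    intro i hi
    set n : ι → ℝ := fun i => ((Finset.univ.filter fun v => c v = i).card : ℝ) with hn
    set N : Finset ι → ℝ := fun S => ((partialTransversals H c d S).card : ℝ) with hN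
    change n i * N S ≤ 2 * N (insert i S)
    have hN0 : ∀ S, 0 ≤ N S := fun S => Nat.cast_nonneg _
    have herase : ∀ j ∈ S, N (S.erase j) ≤ N S / (2 * t) := by
      intro j hj
      have h := ih _ (Finset.erase_ssubset hj) j (Finset.notMem_erase j S)
      rw [Finset.insert_erase hj] at h
      change n j * N (S.erase j) ≤ 2 * N S at h
      have h4 := mul_le_mul_of_nonneg_right (hsize j) (hN0 (S.erase j))
      rw [le_div_iff₀ (by positivity)]
      change 4 * t * N (S.erase j) ≤ n j * N (S.erase j) at h4
      linarith
    have hmain : n i * N S ≤ N (insert i S) +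
        ∑ p ∈ Finset.univ.filter (fun p : V × V => c p.1 = i ∧ c p.2 ∈ S ∧ H.Adj p.1 p.2),
          N (S.erase (c p.2)) := by
      simp only [hn, hN]
      exact_mod_cast card_mul_card_partialTransversals_le (H := H) (c := c) (d := d) hi
    have hpairs : ((Finset.univ.filter fun p : V × V =>
        c p.1 = i ∧ c p.2 ∈ S ∧ H.Adj p.1 p.2).card : ℝ) ≤ t * n i := by
      refine le_trans (Nat.cast_le.2 (Finset.card_le_card ?_)) (hedges i)
      intro p hp
      simp only [Finset.mem_filter, Finset.mem_univ, true_and] at hp ⊢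
      exact ⟨hp.1, hp.2.2⟩
    have hsum : ∑ p ∈ Finset.univ.filter (fun p : V × V => c p.1 = i ∧ c p.2 ∈ S ∧ H.Adj p.1 p.2),
        N (S.erase (c p.2)) ≤ n i * N S / 2 := by
      refine (Finset.sum_le_card_nsmul _ _ (N S / (2 * t)) fun p hp =>
        herase _ (Finset.mem_filter.1 hp).2.2.1).trans ?_
      rw [nsmul_eq_mul]
      refine (mul_le_mul_of_nonneg_right hpairs (by have := hN0 S; positivity)).trans
        (le_of_eq ?_)
      field_simp
    linarith

theorem partialTransversals_nonempty {t : ℝ} (ht : 0 < t)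
    (hsize : ∀ i, 4 * t ≤ ((Finset.univ.filter fun v => c v = i).card : ℝ))
    (hedges : ∀ i, ((Finset.univ.filter fun p : V × V => c p.1 = i ∧ H.Adj p.1 p.2).card : ℝ) ≤
      t * (Finset.univ.filter fun v => c v = i).card)
    (S : Finset ι) : (partialTransversals H c d S).Nonempty := by
  induction S using Finset.induction_on with
  | empty => exact ⟨d, by simp [mem_partialTransversals]⟩
  | insert i S hi ih =>
    rw [← Finset.card_pos] at ih ⊢
    have h := card_partialTransversals_insert_ge (d := d) ht hsize hedges S i hi
    have hpos : (0 : ℝ) < (partialTransversals H c d S).card := by exact_mod_cast ih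
    have := mul_pos (lt_of_lt_of_le (by positivity) (hsize i)) hpos
    exact_mod_cast (by linarith : (0 : ℝ) < (partialTransversals H c d (insert i S)).card)

end PartialTransversals

/-- If each colour class of a proper `r`-colouring of `H` satisfies
`n_i ≥ 2e·t` and `m_i ≤ t·n_i` (where `m_i` counts edges with an endpoint in
the class), then `H` has an independent set with one vertex per class. -/
theorem rainbow_independent_set_of_few_edges {V : Type} [Fintype V]
    {H : SimpleGraph V} (r : ℕ) (C : Fin r → Set V)
    (hpart : ∀ v : V, ∃! i, v ∈ C i)
    (hindep : ∀ i, ∀ u ∈ C i, ∀ v ∈ C i, ¬ H.Adj u v)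
    (t : ℝ) (ht : 0 < t)
    (hsize : ∀ i, 2 * Real.exp 1 * t ≤ ((C i).ncard : ℝ))
    (hedges : ∀ i,
      (({e ∈ H.edgeSet | ∃ v ∈ C i, v ∈ e}).ncard : ℝ) ≤ t * (C i).ncard) :
    ∃ x : Fin r → V, (∀ i, x i ∈ C i) ∧
      ∀ i j, i ≠ j → ¬ H.Adj (x i) (x j) := by
  classical
  choose c hc huniq using hpart
  have hmem : ∀ v i, v ∈ C i ↔ c v = i := fun v i =>
    ⟨fun h => (huniq v i h).symm, fun h => h ▸ hc v⟩
  have hcard : ∀ i, (C i).ncard = (Finset.univ.filter fun v => c v = i).card := fun i => by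
    rw [← Set.ncard_coe_finset]
    congr 1
    ext v
    simp [hmem]
  have hpairs : ∀ i, (Finset.univ.filter fun p : V × V => c p.1 = i ∧ H.Adj p.1 p.2).card ≤
      {e ∈ H.edgeSet | ∃ v ∈ C i, v ∈ e}.ncard := fun i => by
    rw [← Set.ncard_coe_finset]
    refine Set.ncard_le_ncard_of_injOn (fun p => s(p.1, p.2)) ?_ ?_ (Set.toFinite _)
    · intro p hp
      simp only [Finset.coe_filter, Finset.mem_univ, true_and, Set.mem_ofPred_eq] at hp
      exact ⟨hp.2, p.1, (hmem _ _).2 hp.1, Sym2.mem_mk_left _ _⟩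
    · rintro ⟨a, b⟩ hp ⟨a', b'⟩ hq h
      simp only [Finset.coe_filter, Finset.mem_univ, true_and, Set.mem_ofPred_eq] at hp hq
      rcases Sym2.eq_iff.1 h with ⟨rfl, rfl⟩ | ⟨rfl, rfl⟩
      · rfl
      · exact absurd hp.2 (hindep i _ ((hmem _ _).2 hp.1) _ ((hmem _ _).2 hq.1))
  have hsize' : ∀ i, 4 * t ≤ ((Finset.univ.filter fun v => c v = i).card : ℝ) := fun i => by
    have h := hsize i
    rw [hcard] at h
    nlinarith [Real.add_one_le_exp (1 : ℝ)]
  have hedges' : ∀ i, ((Finset.univ.filter fun p : V × V => c p.1 = i ∧ H.Adj p.1 p.2).card : ℝ) ≤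
      t * (Finset.univ.filter fun v => c v = i).card := fun i => by
    have h := hedges i
    rw [hcard] at h
    exact (Nat.cast_le.2 (hpairs i)).trans h
  have hne : ∀ i, ∃ v, c v = i := fun i => by
    have h : (0 : ℝ) < (Finset.univ.filter fun v => c v = i).card :=
      lt_of_lt_of_le (by positivity) (hsize' i)
    obtain ⟨v, hv⟩ := Finset.card_pos.1 (Nat.cast_pos.1 h)
    exact ⟨v, (Finset.mem_filter.1 hv).2⟩
  choose d _ using hne
  obtain ⟨x, hx⟩ := partialTransversals_nonempty (d := d) ht hsize' hedges' Finset.univ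
  obtain ⟨hxc, -, hadj⟩ := mem_partialTransversals.1 hx
  exact ⟨x, fun i => (hmem _ _).2 (hxc i (Finset.mem_univ i)),
    fun i j _ => hadj i (Finset.mem_univ i) j (Finset.mem_univ j)⟩
end

section
/- For all integers d ≥ 1 and r ≥ 2 and every integer n ≥ 1, there exists a finite simple graph H with a proper r-colouring with colour classes V₁, …, V_r such that |V₁| = d(r−1), |V_i| = n for all i ∈ {2, …, r}, the induced subgraph H[V_i ∪ V_j] is d-degenerate for all distinct i, j ∈ {1, …, r}, and yet H has no independent set containing exactly one vertex from each colour class. (Hence the lower bound 2e(2r−3)d on the class sizes in the rainbow independent set lemma is best possible up to a constant factor.) -/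
open SimpleGraph

theorem IsDegenerate.induce {W : Type*} [Finite W] {d : ℕ} {G : SimpleGraph W}
    (h : IsDegenerate d G) (S : Set W) : IsDegenerate d (G.induce S) := by
  intro s hs
  obtain ⟨_, ⟨v, hv, rfl⟩, hdeg⟩ := h (Subtype.val '' s) (hs.image _)
  refine ⟨v, hv, le_trans ?_ hdeg⟩
  exact Set.ncard_le_ncard_of_injOn Subtype.val
    (fun u hu => ⟨⟨u, hu.1, rfl⟩, hu.2⟩) Subtype.val_injective.injOn (Set.toFinite _)

/-- The disjoint union of `k` copies of the complete bipartite graph `K_{d,n}`. -/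
def bicliqueUnion (k d n : ℕ) : SimpleGraph ((Fin k × Fin d) ⊕ (Fin k × Fin n)) where
  Adj
    | .inl a, .inr b => a.1 = b.1
    | .inr b, .inl a => a.1 = b.1
    | _, _ => False
  symm := ⟨by rintro (a | a) (b | b) h <;> exact h⟩
  loopless := ⟨by rintro (a | a) h <;> exact h⟩

/-- The colouring of `bicliqueUnion k d n` in which all the sides of size `d` share
the colour `0` and each side of size `n` has a colour of its own. -/
def bicliqueUnionColour (k d n : ℕ) : (Fin k × Fin d) ⊕ (Fin k × Fin n) → Fin (k + 1)
  | .inl _ => 0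
  | .inr b => b.1.succ

theorem isDegenerate_bicliqueUnion (k d n : ℕ) : IsDegenerate d (bicliqueUnion k d n) := by
  intro s hs
  by_cases hr : ∃ b, Sum.inr b ∈ s
  · obtain ⟨b, hb⟩ := hr
    refine ⟨_, hb, ?_⟩
    calc _ ≤ (Set.range fun t : Fin d =>
          (Sum.inl (b.1, t) : (Fin k × Fin d) ⊕ (Fin k × Fin n))).ncard := by
          refine Set.ncard_le_ncard ?_ (Set.toFinite _)
          rintro (⟨i, t⟩ | c) ⟨-, h⟩
          · obtain rfl : i = b.1 := h
            exact ⟨t, rfl⟩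
          · exact h.elim
      _ ≤ d := by
          rw [← Set.image_univ]
          exact (Set.ncard_image_le Set.finite_univ).trans (by simp [Set.ncard_univ])
  · push Not at hr
    obtain ⟨a, ha⟩ := hs
    refine ⟨a, ha, ?_⟩
    rw [Set.ncard_eq_zero (Set.toFinite _) |>.2]
    · exact Nat.zero_le d
    · rw [Set.eq_empty_iff_forall_notMem]
      rintro u ⟨hu, h⟩
      rcases a with a | a <;> rcases u with u | u
      · exact h
      · exact hr _ hu
      · exact hr _ ha
      · exact h

theorem ncard_bicliqueUnionColour_zero (k d n : ℕ) :
    (bicliqueUnionColour k d n ⁻¹' {0}).ncard = d * k := by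
  have h : bicliqueUnionColour k d n ⁻¹' {0} = Sum.inl '' Set.univ := by
    ext (a | b) <;> simp [bicliqueUnionColour]
  rw [h, Set.ncard_image_of_injective _ Sum.inl_injective, Set.ncard_univ]
  simp [mul_comm]

theorem ncard_bicliqueUnionColour_succ (k d n : ℕ) (i : Fin k) :
    (bicliqueUnionColour k d n ⁻¹' {i.succ}).ncard = n := by
  have h : bicliqueUnionColour k d n ⁻¹' {i.succ} =
      (fun t : Fin n => Sum.inr (i, t)) '' Set.univ := by
    ext (a | ⟨j, t⟩)
    · simpa [bicliqueUnionColour] using (Fin.succ_ne_zero i).symm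
    · simp [bicliqueUnionColour, eq_comm]
  rw [h, Set.ncard_image_of_injective _ (fun a b hab => by simpa using hab), Set.ncard_univ]
  simp

/-- The size bound in the rainbow independent set lemma is sharp up to a
constant: for all `d ≥ 1`, `r ≥ 2`, `n ≥ 1` there is a properly `r`-coloured
graph with `|V₁| = d(r-1)`, `|V_i| = n` for `i ≥ 2`, all pairs of classes
inducing `d`-degenerate subgraphs, and no rainbow independent set. -/
theorem rainbow_independent_set_lower_bound (d r n : ℕ)
    (hd : 1 ≤ d) (hr : 2 ≤ r) (hn : 1 ≤ n) :
    ∃ (V : Type) (_ : Fintype V) (H : SimpleGraph V) (C : Fin r → Set V),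
      (∀ v : V, ∃! i, v ∈ C i) ∧
      (∀ i, ∀ u ∈ C i, ∀ v ∈ C i, ¬ H.Adj u v) ∧
      (C ⟨0, by omega⟩).ncard = d * (r - 1) ∧
      (∀ i : Fin r, i ≠ ⟨0, by omega⟩ → (C i).ncard = n) ∧
      (∀ i j, i ≠ j → IsDegenerate d (H.induce (C i ∪ C j))) ∧
      ¬ ∃ x : Fin r → V, (∀ i, x i ∈ C i) ∧
        ∀ i j, i ≠ j → ¬ H.Adj (x i) (x j) := by
  obtain ⟨k, rfl⟩ : ∃ k, r = k + 1 := ⟨r - 1, by omega⟩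
  refine ⟨_, inferInstance, bicliqueUnion k d n, fun i => bicliqueUnionColour k d n ⁻¹' {i},
    fun v => ⟨_, rfl, fun j hj => hj.symm⟩, ?_, ncard_bicliqueUnionColour_zero k d n, ?_,
    fun i j _ => (isDegenerate_bicliqueUnion k d n).induce _, ?_⟩
  · rintro i (a | a) ha (b | b) hb h
    · exact h
    · exact Fin.succ_ne_zero _ (hb.trans ha.symm)
    · exact Fin.succ_ne_zero _ (ha.trans hb.symm)
    · exact h
  · intro i hi
    obtain ⟨j, rfl⟩ := Fin.exists_succ_eq.2 hi
    exact ncard_bicliqueUnionColour_succ k d n j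
  · rintro ⟨x, hx, hind⟩
    have h0 : bicliqueUnionColour k d n (x 0) = 0 := hx 0
    rcases hx0 : x 0 with a | b
    · have h1 : bicliqueUnionColour k d n (x a.1.succ) = a.1.succ := hx a.1.succ
      rcases hx1 : x a.1.succ with c | c
      · rw [hx1] at h1
        exact Fin.succ_ne_zero _ h1.symm
      · rw [hx1] at h1
        refine hind 0 a.1.succ (Fin.succ_ne_zero _).symm ?_
        rw [hx0, hx1]
        exact (Fin.succ_injective _ h1).symm
    · rw [hx0] at h0
      exact Fin.succ_ne_zero _ h0
end

section
/- Let r ≥ 2 and d ≥ 1 be integers, and let V₁, …, V_r be the colour classes of a proper r-colouring of a finite simple graph H. Suppose that |V_i| ≥ r(r−1)d + 1 for all i ∈ {1, …, r}, and that the induced subgraph H[V_i ∪ V_j] is d-degenerate for all distinct i, j ∈ {1, …, r}. Then there exists an independent set {x₁, …, x_r} of H with x_i ∈ V_i for each i. -/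
open SimpleGraph

lemma interedges_card_le_of_degenerate {V : Type*} [DecidableEq V] (G : SimpleGraph V)
    [DecidableRel G.Adj] (d : ℕ) (A B : Finset V)
    (h : ∀ T ⊆ A ∪ B, T.Nonempty → ∃ v ∈ T, {u ∈ T | G.Adj v u}.card ≤ d) :
    (G.interedges A B).card ≤ d * (A.card + B.card) := by
  induction hm : A.card + B.card using Nat.strong_induction_on generalizing A B with
  | _ m ih =>
  subst hm
  rcases (A ∪ B).eq_empty_or_nonempty with he | hne
  · obtain ⟨rfl, rfl⟩ := Finset.union_eq_empty.mp he
    simp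
  obtain ⟨v, hv, hvd⟩ := h _ subset_rfl hne
  rcases Finset.mem_union.mp hv with hvA | hvB
  · have hcard := Finset.card_erase_add_one hvA
    have hrec := ih ((A.erase v).card + B.card) (by lia) (A.erase v) B
      (fun T hT => h T (hT.trans (Finset.union_subset_union_left (A.erase_subset v)))) rfl
    have hsub : G.interedges A B ⊆
        G.interedges (A.erase v) B ∪ {u ∈ A ∪ B | G.Adj v u}.image (Prod.mk v) := by
      rintro ⟨a, b⟩ hab
      simp only [Finset.mem_union, mem_interedges_iff, Finset.mem_erase, Finset.mem_image,
        Finset.mem_filter, Prod.mk.injEq] at hab ⊢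
      by_cases hav : a = v
      · subst hav
        exact Or.inr ⟨b, ⟨Or.inr hab.2.1, hab.2.2⟩, rfl, rfl⟩
      · exact Or.inl ⟨⟨hav, hab.1⟩, hab.2⟩
    have h1 := (Finset.card_le_card hsub).trans (Finset.card_union_le _ _)
    have h2 := (Finset.card_image_le (s := {u ∈ A ∪ B | G.Adj v u}) (f := Prod.mk v)).trans hvd
    rw [← hcard]
    linarith
  · have hcard := Finset.card_erase_add_one hvB
    have hrec := ih (A.card + (B.erase v).card) (by lia) A (B.erase v)
      (fun T hT => h T (hT.trans (Finset.union_subset_union_right (B.erase_subset v)))) rfl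
    have hsub : G.interedges A B ⊆
        G.interedges A (B.erase v) ∪ {u ∈ A ∪ B | G.Adj v u}.image (fun u => (u, v)) := by
      rintro ⟨a, b⟩ hab
      simp only [Finset.mem_union, mem_interedges_iff, Finset.mem_erase, Finset.mem_image,
        Finset.mem_filter, Prod.mk.injEq] at hab ⊢
      by_cases hbv : b = v
      · subst hbv
        exact Or.inr ⟨a, ⟨Or.inl hab.1, hab.2.2.symm⟩, rfl, rfl⟩
      · exact Or.inl ⟨hab.1, ⟨hbv, hab.2.1⟩, hab.2.2⟩
    have h1 := (Finset.card_le_card hsub).trans (Finset.card_union_le _ _)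
    have h2 := (Finset.card_image_le (s := {u ∈ A ∪ B | G.Adj v u})
      (f := fun u => (u, v))).trans hvd
    rw [← hcard]
    linarith

lemma IsDegenerate.exists_card_filter_le {V : Type*} {G : SimpleGraph V} [DecidableRel G.Adj]
    {d : ℕ} {S : Set V} (h : IsDegenerate d (G.induce S)) {T : Finset V} (hTS : ↑T ⊆ S)
    (hT : T.Nonempty) : ∃ v ∈ T, {u ∈ T | G.Adj v u}.card ≤ d := by
  obtain ⟨w, hw⟩ := hT
  obtain ⟨v, hv, hvd⟩ := h {u | (u : V) ∈ T} ⟨⟨w, hTS hw⟩, hw⟩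
  refine ⟨v, hv, ?_⟩
  rw [← Set.ncard_coe_finset]
  convert hvd using 1
  rw [← Set.ncard_image_of_injective _ Subtype.val_injective]
  congr 1
  ext u
  constructor
  · intro hu
    obtain ⟨huT, hadj⟩ := Finset.mem_filter.mp hu
    exact ⟨⟨u, hTS huT⟩, ⟨huT, hadj⟩, rfl⟩
  · rintro ⟨u, ⟨huT, hadj⟩, rfl⟩
    exact Finset.mem_filter.mpr ⟨huT, hadj⟩

lemma card_piFinset_fix_two_mul {ι V : Type*} [Fintype ι] [DecidableEq ι] [DecidableEq V]
    (D : ι → Finset V) {i j : ι} (hij : i ≠ j) (a b : V) :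
    (Fintype.piFinset (Function.update (Function.update D i {a}) j {b})).card *
      ((D i).card * (D j).card) = (Fintype.piFinset D).card := by
  have key (k : ι) :
      (Function.update (Function.update D i {a}) j {b} k).card *
        ((if k = i then (D i).card else 1) * (if k = j then (D j).card else 1)) =
      (D k).card := by
    by_cases hkj : k = j
    · subst hkj
      simp [hij.symm]
    · by_cases hki : k = i
      · subst hki
        simp [hkj]
      · simp [hkj, hki]
  rw [Fintype.card_piFinset, Fintype.card_piFinset, ← Finset.prod_congr rfl fun k _ => key k,
    Finset.prod_mul_distrib, Finset.prod_mul_distrib]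
  simp

lemma card_filter_adj_piFinset_mul_le {ι V : Type*} [Fintype ι] [DecidableEq ι] [DecidableEq V]
    (G : SimpleGraph V) [DecidableRel G.Adj] (D : ι → Finset V) {i j : ι} (hij : i ≠ j) :
    {x ∈ Fintype.piFinset D | G.Adj (x i) (x j)}.card * ((D i).card * (D j).card) ≤
      (G.interedges (D i) (D j)).card * (Fintype.piFinset D).card := by
  have hsub : {x ∈ Fintype.piFinset D | G.Adj (x i) (x j)} ⊆
      (G.interedges (D i) (D j)).biUnion fun p =>
        Fintype.piFinset (Function.update (Function.update D i {p.1}) j {p.2}) := by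
    intro x hx
    rw [Finset.mem_filter, Fintype.mem_piFinset] at hx
    refine Finset.mem_biUnion.mpr
      ⟨(x i, x j), (mem_interedges_iff G).mpr ⟨hx.1 i, hx.1 j, hx.2⟩, ?_⟩
    rw [Fintype.mem_piFinset]
    intro k
    by_cases hkj : k = j
    · subst hkj
      simp
    · by_cases hki : k = i
      · subst hki
        simp [hkj]
      · simpa [hkj, hki] using hx.1 k
  calc _ ≤ (∑ p ∈ G.interedges (D i) (D j),
          (Fintype.piFinset (Function.update (Function.update D i {p.1}) j {p.2})).card) *
            ((D i).card * (D j).card) :=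
        Nat.mul_le_mul_right _ ((Finset.card_le_card hsub).trans Finset.card_biUnion_le)
    _ = _ := by
        rw [Finset.sum_mul, Finset.sum_congr rfl fun p _ =>
          card_piFinset_fix_two_mul D hij p.1 p.2, Finset.sum_const, smul_eq_mul]

/-- If each colour class of a proper `r`-colouring of `H` has at least
`r(r-1)d + 1` vertices, and every two colour classes induce a `d`-degenerate
subgraph, then `H` has an independent set with one vertex per class. -/
theorem rainbow_independent_set_of_degenerate_greedy {V : Type} [Fintype V]
    {H : SimpleGraph V} (r d : ℕ) (hr : 2 ≤ r) (hd : 1 ≤ d)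
    (C : Fin r → Set V)
    (hpart : ∀ v : V, ∃! i, v ∈ C i)
    (hindep : ∀ i, ∀ u ∈ C i, ∀ v ∈ C i, ¬ H.Adj u v)
    (hsize : ∀ i, r * (r - 1) * d + 1 ≤ (C i).ncard)
    (hdeg : ∀ i j, i ≠ j → IsDegenerate d (H.induce (C i ∪ C j))) :
    ∃ x : Fin r → V, (∀ i, x i ∈ C i) ∧
      ∀ i j, i ≠ j → ¬ H.Adj (x i) (x j) := by
  classical
  set n := r * (r - 1) * d + 1 with hn
  have hD (i : Fin r) : ∃ D : Finset V, ↑D ⊆ C i ∧ D.card = n := by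
    obtain ⟨D, hDC, hDn⟩ := Finset.exists_subset_card_eq
      ((hsize i).trans_eq (Set.ncard_eq_toFinset_card' (C i)))
    exact ⟨D, fun v hv => Set.mem_toFinset.mp (hDC hv), hDn⟩
  choose D hDC hDn using hD
  set X := Fintype.piFinset D with hX
  have hXpos : 0 < X.card := by
    simp [hX, Fintype.card_piFinset, hDn, hn]
  have hpair (i j : Fin r) (hij : i ≠ j) :
      {x ∈ X | H.Adj (x i) (x j)}.card * n ≤ 2 * d * X.card := by
    have h1 := card_filter_adj_piFinset_mul_le H D hij
    have h2 := interedges_card_le_of_degenerate H d (D i) (D j) fun T hT hne =>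
      (hdeg i j hij).exists_card_filter_le (fun v hv => by
        rcases Finset.mem_union.mp (hT hv) with h | h
        · exact Or.inl (hDC i h)
        · exact Or.inr (hDC j h)) hne
    rw [hDn, hDn] at h1 h2
    have h3 := h1.trans (Nat.mul_le_mul_right _ h2)
    refine Nat.le_of_mul_le_mul_right (c := n) ?_ (Nat.succ_pos _)
    linarith
  by_contra! hcon
  have hcover : X ⊆ Finset.univ.biUnion fun j : Fin r =>
      (Finset.Iio j).biUnion fun i => {x ∈ X | H.Adj (x i) (x j)} := by
    intro x hx
    obtain ⟨i, j, hij, hadj⟩ := hcon x fun i => hDC i (Fintype.mem_piFinset.mp hx i)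
    simp only [Finset.mem_biUnion, Finset.mem_univ, true_and, Finset.mem_Iio, Finset.mem_filter]
    rcases lt_or_gt_of_ne hij with h | h
    · exact ⟨j, i, h, hx, hadj⟩
    · exact ⟨i, j, h, hx, hadj.symm⟩
  have hle : X.card * n ≤ r * (r - 1) * d * X.card :=
    calc X.card * n
        ≤ (∑ j : Fin r, ∑ i ∈ Finset.Iio j, {x ∈ X | H.Adj (x i) (x j)}.card) * n :=
          Nat.mul_le_mul_right _ <| (Finset.card_le_card hcover).trans <|
            Finset.card_biUnion_le.trans <| Finset.sum_le_sum fun _ _ => Finset.card_biUnion_le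
      _ ≤ ∑ j : Fin r, ∑ i ∈ Finset.Iio j, 2 * d * X.card := by
          simp only [Finset.sum_mul]
          exact Finset.sum_le_sum fun j _ => Finset.sum_le_sum fun i hi =>
            hpair i j (Finset.mem_Iio.mp hi).ne
      _ = (∑ j ∈ Finset.range r, j) * 2 * (d * X.card) := by
          rw [← Fin.sum_univ_eq_sum_range (fun j => j)]
          simp only [Finset.sum_const, Fin.card_Iio, smul_eq_mul, ← Finset.sum_mul]
          ring
      _ = r * (r - 1) * d * X.card := by
          rw [Finset.sum_range_id_mul_two]
          ring
  rw [hn] at hle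
  linarith
end
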